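/- There exists a compact operator S on H such that (S) is not K(H)-soft, i.e., (S) ≠ K(H)(S), and consequently all three inclusions ⟨S⟩_{K(H)} ⊆ (S)_{K(H)}^ℝ ⊆ (S)_{K(H)} ⊆ (S) are strict. (Such an S is the diagonal operator with singular values ⟨1/n⟩.) -/

import Mathlib

open scoped BigOperators
open TopologicalSpace

variable {H : Type*} [NormedAddCommGroup H] [InnerProductSpace ℂ H] [CompleteSpace H]

/-- `J` is a two-sided ideal of `B(H)`: an additive subgroup closed under left and
right multiplication by arbitrary bounded operators. -/
def IsBHIdeal (J : Set (H →L[ℂ] H)) : Prop :=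
  (0 : H →L[ℂ] H) ∈ J ∧
  (∀ x ∈ J, ∀ y ∈ J, x + y ∈ J) ∧
  (∀ x ∈ J, -x ∈ J) ∧
  ∀ (A : H →L[ℂ] H), ∀ x ∈ J, A * x ∈ J ∧ x * A ∈ J

/-- `I` is a `J`-ideal: an additive subgroup of `B(H)` contained in `J` and closed
under left and right multiplication by elements of `J`. -/
def IsSubideal (J I : Set (H →L[ℂ] H)) : Prop :=
  I ⊆ J ∧ (0 : H →L[ℂ] H) ∈ I ∧
  (∀ x ∈ I, ∀ y ∈ I, x + y ∈ I) ∧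
  (∀ x ∈ I, -x ∈ I) ∧
  ∀ A ∈ J, ∀ x ∈ I, A * x ∈ I ∧ x * A ∈ I

/-- A linear `J`-ideal: a `J`-ideal closed under multiplication by complex scalars. -/
def IsLinearSubideal (J I : Set (H →L[ℂ] H)) : Prop :=
  IsSubideal J I ∧ ∀ (c : ℂ), ∀ x ∈ I, c • x ∈ I

/-- A real linear `J`-ideal: a `J`-ideal closed under multiplication by real scalars. -/
def IsRealSubideal (J I : Set (H →L[ℂ] H)) : Prop :=
  IsSubideal J I ∧ ∀ (r : ℝ), ∀ x ∈ I, r • x ∈ I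

/-- `(𝒮)`: the smallest two-sided ideal of `B(H)` containing `𝒮`. -/
def genBH (𝒮 : Set (H →L[ℂ] H)) : Set (H →L[ℂ] H) :=
  ⋂₀ {I | IsBHIdeal I ∧ 𝒮 ⊆ I}

/-- `⟨𝒮⟩_J`: the smallest `J`-ideal containing `𝒮`. -/
def genSub (J 𝒮 : Set (H →L[ℂ] H)) : Set (H →L[ℂ] H) :=
  ⋂₀ {I | IsSubideal J I ∧ 𝒮 ⊆ I}

/-- `(𝒮)_J`: the smallest linear `J`-ideal containing `𝒮`. -/
def genLin (J 𝒮 : Set (H →L[ℂ] H)) : Set (H →L[ℂ] H) :=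
  ⋂₀ {I | IsLinearSubideal J I ∧ 𝒮 ⊆ I}

/-- `(𝒮)_J^ℝ`: the smallest real linear `J`-ideal containing `𝒮`. -/
def genReal (J 𝒮 : Set (H →L[ℂ] H)) : Set (H →L[ℂ] H) :=
  ⋂₀ {I | IsRealSubideal J I ∧ 𝒮 ⊆ I}

/-- `J(𝒮)`: all finite sums `Σ Aᵢ Xᵢ` with `Aᵢ ∈ J` and `Xᵢ ∈ (𝒮)`. -/
def JGen (J 𝒮 : Set (H →L[ℂ] H)) : Set (H →L[ℂ] H) :=
  {T | ∃ (n : ℕ) (A X : Fin n → (H →L[ℂ] H)),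
    (∀ i, A i ∈ J ∧ X i ∈ genBH 𝒮) ∧ T = ∑ i, A i * X i}

/-- `J(𝒮)J`: all finite sums `Σ Aᵢ Xᵢ Bᵢ` with `Aᵢ, Bᵢ ∈ J` and `Xᵢ ∈ (𝒮)`. -/
def JGenJ (J 𝒮 : Set (H →L[ℂ] H)) : Set (H →L[ℂ] H) :=
  {T | ∃ (n : ℕ) (A X B : Fin n → (H →L[ℂ] H)),
    (∀ i, A i ∈ J ∧ X i ∈ genBH 𝒮 ∧ B i ∈ J) ∧ T = ∑ i, A i * X i * B i}

/-- `JS + SJ + J(S)J = {AS + SB + Y : A, B ∈ J, Y ∈ J(S)J}`. -/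
def JSplus (J : Set (H →L[ℂ] H)) (S : H →L[ℂ] H) : Set (H →L[ℂ] H) :=
  {T | ∃ A ∈ J, ∃ B ∈ J, ∃ Y ∈ JGenJ J {S}, T = A * S + S * B + Y}

/-- `K(H)`: the compact operators on `H`. -/
def KH : Set (H →L[ℂ] H) := {T | IsCompactOperator ⇑T}

/-- `T` is a finite-rank operator: its range is finite-dimensional. -/
def IsFiniteRank (T : H →L[ℂ] H) : Prop :=
  FiniteDimensional ℂ (LinearMap.range (T : H →ₗ[ℂ] H))

set_option linter.unusedSectionVars false

section ApproximationNumbers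

open Filter

theorem Orthonormal.norm_sq_sum_smul {ι : Type*} {v : ι → H} (hv : Orthonormal ℂ v)
    (l : ι → ℂ) (s : Finset ι) : ‖∑ i ∈ s, l i • v i‖ ^ 2 = ∑ i ∈ s, ‖l i‖ ^ 2 := by
  have h := hv.inner_sum l l s
  rw [inner_self_eq_norm_sq_to_K] at h
  simp_rw [RCLike.conj_mul] at h
  exact_mod_cast h

theorem Orthonormal.norm_sum_smul_inner_le {ι : Type*} {v : ι → H} (hv : Orthonormal ℂ v)
    {l : ι → ℂ} {s : Finset ι} {C : ℝ} (hC : 0 ≤ C) (hl : ∀ i ∈ s, ‖l i‖ ≤ C) (x : H) :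
    ‖∑ i ∈ s, (l i * inner ℂ (v i) x) • v i‖ ≤ C * ‖x‖ := by
  refine le_of_sq_le_sq ?_ (by positivity)
  rw [hv.norm_sq_sum_smul, mul_pow]
  calc ∑ i ∈ s, ‖l i * inner ℂ (v i) x‖ ^ 2
      ≤ ∑ i ∈ s, C ^ 2 * ‖inner ℂ (v i) x‖ ^ 2 := by
        refine Finset.sum_le_sum fun i hi => ?_
        rw [norm_mul, mul_pow]
        gcongr
        exact hl i hi
    _ ≤ C ^ 2 * ‖x‖ ^ 2 := by
        rw [← Finset.mul_sum]
        gcongr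
        exact hv.sum_inner_products_le x

theorem exists_orthonormal_nat (hinf : ¬ FiniteDimensional ℂ H) :
    ∃ v : ℕ → H, Orthonormal ℂ v := by
  obtain ⟨w, b, -⟩ := exists_hilbertBasis ℂ H
  have : Infinite w := by
    by_contra h
    rw [not_infinite_iff_finite] at h
    have := Fintype.ofFinite w
    exact hinf b.toOrthonormalBasis.toBasis.finiteDimensional_of_finite
  exact ⟨fun n => b (Infinite.natEmbedding w n),
    b.orthonormal.comp _ (Infinite.natEmbedding w).injective⟩

theorem IsCompactOperator.exists_rank_le_norm_sub_le {A : H →L[ℂ] H} (hA : IsCompactOperator ⇑A)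
    {ε : ℝ} (hε : 0 < ε) :
    ∃ (r : ℕ) (F : H →L[ℂ] H), LinearMap.rank (F : H →ₗ[ℂ] H) ≤ r ∧ ‖A - F‖ ≤ ε := by
  have hK := (hA.isCompact_closure_image_closedBall (f := (A : H →ₗ[ℂ] H)) 1).totallyBounded
  obtain ⟨t, ht, hcover⟩ := Metric.totallyBounded_iff.1 hK ε hε
  have := FiniteDimensional.span_of_finite ℂ ht
  set U := Submodule.span ℂ t
  refine ⟨Module.finrank ℂ U, U.starProjection * A, ?_, ?_⟩
  · calc LinearMap.rank ((U.starProjection * A : H →L[ℂ] H) : H →ₗ[ℂ] H)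
        ≤ LinearMap.rank (U.starProjection : H →ₗ[ℂ] H) :=
          LinearMap.rank_comp_le_left (A : H →ₗ[ℂ] H) _
      _ ≤ Module.rank ℂ U := by
          refine Submodule.rank_mono ?_
          rintro _ ⟨x, rfl⟩
          exact U.starProjection_apply_mem x
      _ = _ := (Module.finrank_eq_rank ℂ U).symm
  · refine ContinuousLinearMap.opNorm_le_of_unit_norm hε.le fun x hx => ?_
    have hx' : A x ∈ closure ((A : H →ₗ[ℂ] H) '' Metric.closedBall 0 1) :=
      subset_closure ⟨x, by simp [hx], rfl⟩
    obtain ⟨y, hy, hxy⟩ := Set.mem_iUnion₂.1 (hcover hx')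
    have hmin := U.starProjection_minimal (A x)
    change ‖A x - U.starProjection (A x)‖ ≤ ε
    rw [hmin]
    refine (ciInf_le ⟨0, ?_⟩ (⟨y, Submodule.subset_span hy⟩ : U)).trans ?_
    · rintro _ ⟨z, rfl⟩
      exact norm_nonneg _
    · exact (mem_ball_iff_norm.1 hxy).le

/-- Operators whose approximation numbers are, up to a dilation, `o(1 / n ^ 2)`. -/
def littleOIdeal (H : Type*) [NormedAddCommGroup H] [InnerProductSpace ℂ H] :
    Set (H →L[ℂ] H) :=
  {T | ∃ C : ℕ, ∀ ε : ℝ, 0 < ε → ∀ᶠ n : ℕ in atTop, ∃ F : H →L[ℂ] H,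
    LinearMap.rank (F : H →ₗ[ℂ] H) ≤ ((C * n : ℕ) : Cardinal) ∧
      ‖T - F‖ * ((n : ℝ) + 1) ^ 2 ≤ ε}

theorem mul_mem_littleOIdeal (A : H →L[ℂ] H) {T : H →L[ℂ] H} (hT : T ∈ littleOIdeal H) :
    A * T ∈ littleOIdeal H ∧ T * A ∈ littleOIdeal H := by
  obtain ⟨C, hC⟩ := hT
  refine ⟨⟨C, fun ε hε => ?_⟩, ⟨C, fun ε hε => ?_⟩⟩ <;>
    filter_upwards [hC (ε / (‖A‖ + 1)) (by positivity)] with n ⟨F, hF, hn⟩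
  · refine ⟨A * F, (LinearMap.rank_comp_le_right (F : H →ₗ[ℂ] H) (A : H →ₗ[ℂ] H)).trans hF, ?_⟩
    rw [le_div_iff₀ (by positivity)] at hn
    rw [← mul_sub]
    calc ‖A * (T - F)‖ * ((n : ℝ) + 1) ^ 2
        ≤ (‖A‖ + 1) * ‖T - F‖ * ((n : ℝ) + 1) ^ 2 := by
          gcongr
          refine (norm_mul_le _ _).trans ?_
          gcongr
          linarith
      _ ≤ ε := by linarith
  · refine ⟨F * A, (LinearMap.rank_comp_le_left (A : H →ₗ[ℂ] H) (F : H →ₗ[ℂ] H)).trans hF, ?_⟩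
    rw [le_div_iff₀ (by positivity)] at hn
    rw [← sub_mul]
    calc ‖(T - F) * A‖ * ((n : ℝ) + 1) ^ 2
        ≤ ‖T - F‖ * (‖A‖ + 1) * ((n : ℝ) + 1) ^ 2 := by
          gcongr
          refine (norm_mul_le _ _).trans ?_
          gcongr
          linarith
      _ ≤ ε := by linarith

theorem isBHIdeal_littleOIdeal : IsBHIdeal (littleOIdeal H) := by
  refine ⟨⟨0, fun ε hε => .of_forall fun n => ⟨0, ?_, ?_⟩⟩, ?_, ?_, ?_⟩
  · simp
  · simpa using hε.le
  · rintro x ⟨C, hC⟩ y ⟨D, hD⟩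
    refine ⟨C + D, fun ε hε => ?_⟩
    filter_upwards [hC (ε / 2) (by positivity), hD (ε / 2) (by positivity)]
      with n ⟨F, hF, hn⟩ ⟨G, hG, hn'⟩
    refine ⟨F + G, ?_, ?_⟩
    · refine (LinearMap.rank_add_le (F : H →ₗ[ℂ] H) (G : H →ₗ[ℂ] H)).trans ?_
      rw [add_mul, Nat.cast_add]
      exact add_le_add hF hG
    · calc ‖x + y - (F + G)‖ * ((n : ℝ) + 1) ^ 2
          ≤ (‖x - F‖ + ‖y - G‖) * ((n : ℝ) + 1) ^ 2 := by
            gcongr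
            rw [add_sub_add_comm]
            exact norm_add_le _ _
        _ ≤ ε := by linarith
  · intro x hx
    simpa using (mul_mem_littleOIdeal (-1) hx).1
  · exact fun A x hx => mul_mem_littleOIdeal A hx

theorem exists_norm_le_of_rank_le {v : ℕ → H} (hv : Orthonormal ℂ v) {T F : H →L[ℂ] H} {n : ℕ}
    (hF : LinearMap.rank (F : H →ₗ[ℂ] H) ≤ n) {d : ℕ → ℂ} {δ : ℝ} (hδ : 0 ≤ δ)
    (hT : ∀ k ≤ n, T (v k) = d k • v k) (hd : ∀ k ≤ n, δ ≤ ‖d k‖) : δ ≤ ‖T - F‖ := by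
  let g : (Fin (n + 1) → ℂ) →ₗ[ℂ] H := Fintype.linearCombination ℂ (fun i : Fin (n + 1) => v i)
  have hfin : FiniteDimensional ℂ (LinearMap.range (F : H →ₗ[ℂ] H)) :=
    Module.rank_lt_aleph0_iff.1 (hF.trans_lt (Cardinal.natCast_lt_aleph0))
  have hlt : Module.finrank ℂ (LinearMap.range (F : H →ₗ[ℂ] H))
      < Module.finrank ℂ (Fin (n + 1) → ℂ) := by
    rw [Module.finrank_fin_fun]
    exact Nat.lt_succ_of_le (Module.finrank_le_of_rank_le hF)
  have hker := LinearMap.ker_ne_bot_of_finrank_lt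
    (f := (F : H →ₗ[ℂ] H).rangeRestrict ∘ₗ g) hlt
  obtain ⟨c, hc, hc0⟩ := (Submodule.ne_bot_iff _).1 hker
  have hFx : F (g c) = 0 := by simpa using congrArg Subtype.val (LinearMap.mem_ker.1 hc)
  have hw : Orthonormal ℂ (fun i : Fin (n + 1) => v i) := hv.comp _ Fin.val_injective
  have hgc : g c = ∑ i, c i • v i := Fintype.linearCombination_apply ..
  have hpos : 0 < ‖g c‖ := by
    have h : 0 < ‖g c‖ ^ 2 := by
      rw [hgc, hw.norm_sq_sum_smul]
      obtain ⟨i, hi⟩ := Function.ne_iff.1 hc0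
      exact Finset.sum_pos' (fun _ _ => by positivity)
        ⟨i, Finset.mem_univ _, by have := norm_pos_iff.2 hi; positivity⟩
    exact (norm_nonneg _).lt_of_ne' fun h0 => by simp [h0] at h
  have hle : δ * ‖g c‖ ≤ ‖T (g c)‖ := by
    refine le_of_sq_le_sq ?_ (norm_nonneg _)
    have : T (g c) = ∑ i : Fin (n + 1), (c i * d i) • v i := by
      rw [hgc, map_sum]
      refine Finset.sum_congr rfl fun i _ => ?_
      rw [map_smul, hT i (Nat.lt_succ_iff.1 i.2), smul_smul]
    rw [this, hw.norm_sq_sum_smul (fun i : Fin (n + 1) => c i * d i), mul_pow, hgc,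
      hw.norm_sq_sum_smul, Finset.mul_sum]
    refine Finset.sum_le_sum fun i _ => ?_
    rw [norm_mul, mul_pow, mul_comm]
    gcongr
    exact hd i (Nat.lt_succ_iff.1 i.2)
  refine le_of_mul_le_mul_right (hle.trans ?_) hpos
  simpa [hFx] using (T - F).le_opNorm (g c)

theorem notMem_littleOIdeal {v : ℕ → H} (hv : Orthonormal ℂ v) {T : H →L[ℂ] H} {d : ℕ → ℂ}
    {c : ℝ} (hc : 0 < c) (hT : ∀ k, T (v k) = d k • v k)
    (hd : ∀ k : ℕ, c / ((k : ℝ) + 1) ^ 2 ≤ ‖d k‖) : T ∉ littleOIdeal H := by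
  rintro ⟨C, hC⟩
  obtain ⟨n, F, hF, hn⟩ := (hC (c / (2 * ((C : ℝ) + 1) ^ 2)) (by positivity)).exists
  have h : c / (((C * n : ℕ) : ℝ) + 1) ^ 2 ≤ ‖T - F‖ :=
    exists_norm_le_of_rank_le hv hF (by positivity) (fun k _ => hT k) fun k hk =>
      le_trans (by gcongr) (hd k)
  have h' : c / (((C : ℝ) + 1) * ((n : ℝ) + 1)) ^ 2 ≤ ‖T - F‖ := by
    refine le_trans ?_ h
    push_cast
    gcongr
    nlinarith [(Nat.cast_nonneg C : (0 : ℝ) ≤ C), (Nat.cast_nonneg n : (0 : ℝ) ≤ n)]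
  have h'' : c / ((C : ℝ) + 1) ^ 2 ≤ c / (2 * ((C : ℝ) + 1) ^ 2) := by
    refine le_trans ?_ hn
    rw [mul_pow, ← div_div, div_le_iff₀ (by positivity)] at h'
    exact h'
  have : 0 < c / ((C : ℝ) + 1) ^ 2 := by positivity
  rw [mul_comm, ← div_div] at h''
  linarith

/-- A compact operator that is diagonal along an orthonormal sequence, with eigenvalues
`1 / (n + 1) ^ 2`. -/
theorem exists_isCompactOperator_diagonal {v : ℕ → H} (hv : Orthonormal ℂ v) :
    ∃ S : H →L[ℂ] H, IsCompactOperator ⇑S ∧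
      (∀ k : ℕ, S (v k) = (1 / ((k : ℂ) + 1) ^ 2) • v k) ∧
      ∀ n : ℕ, ∃ G : H →L[ℂ] H, LinearMap.rank (G : H →ₗ[ℂ] H) ≤ n ∧
        ‖S - G‖ ≤ 1 / ((n : ℝ) + 1) ^ 2 := by
  let s : ℕ → ℂ := fun k => 1 / ((k : ℂ) + 1) ^ 2
  have hs (k : ℕ) : ‖s k‖ = 1 / ((k : ℝ) + 1) ^ 2 := by
    simp only [s, norm_div, norm_one, norm_pow]
    norm_cast
  let R : ℕ → H →L[ℂ] H := fun k => s k • InnerProductSpace.rankOne ℂ (v k) (v k)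
  have hR (k : ℕ) (x : H) : R k x = (s k * inner ℂ (v k) x) • v k := by
    simp [R, smul_smul]
  have hsum : Summable R := by
    refine Summable.of_norm ?_
    have h := (summable_nat_add_iff 1).2 (Real.summable_one_div_nat_pow.2 one_lt_two)
    refine h.congr fun k => ?_
    simp [R, norm_smul, hs, hv.1 k]
  have hlim := hsum.hasSum
  have hlim_nat := hlim.tendsto_sum_nat
  refine ⟨∑' k, R k, ?_, fun k => ?_, fun n => ⟨∑ k ∈ Finset.range n, R k, ?_, ?_⟩⟩
  · refine isCompactOperator_of_tendsto hlim_nat (.of_forall fun n => ?_)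
    refine Submodule.sum_mem (compactOperator (RingHom.id ℂ) H H) fun k _ => ?_
    refine Submodule.smul_mem _ _ ?_
    exact (isCompactOperator_of_locallyCompactSpace_rng
      (ContinuousLinearMap.toSpanSingleton ℂ (v k))).comp_clm (innerSL ℂ (v k))
  · have h := (ContinuousLinearMap.apply ℂ H (v k)).hasSum hlim
    have hk : R k (v k) = s k • v k := by simp [hR, inner_self_eq_norm_sq_to_K, hv.1 k]
    refine h.unique (hk ▸ hasSum_single k fun j hj => ?_)
    simp [hR, hv.2 hj]
  · have : ((∑ k ∈ Finset.range n, R k : H →L[ℂ] H) : H →ₗ[ℂ] H)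
        = ∑ k ∈ Finset.range n, (R k : H →ₗ[ℂ] H) := by simp
    rw [this]
    refine (LinearMap.rank_finsetSum_le _ _).trans ?_
    calc ∑ k ∈ Finset.range n, LinearMap.rank (R k : H →ₗ[ℂ] H)
        ≤ ∑ k ∈ Finset.range n, (1 : Cardinal) := by
          refine Finset.sum_le_sum fun k _ => ?_
          refine (Submodule.rank_mono (t := Submodule.span ℂ {v k}) ?_).trans
            ((rank_span_le _).trans (by simp))
          rintro _ ⟨x, rfl⟩
          exact Submodule.mem_span_singleton.2 ⟨_, (hR k x).symm⟩
      _ = n := by simp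
  · refine ContinuousLinearMap.opNorm_le_bound _ (by positivity) fun x => ?_
    have h := ((ContinuousLinearMap.apply ℂ H x).continuous.tendsto _).comp
      (hlim_nat.sub_const (∑ k ∈ Finset.range n, R k))
    refine le_of_tendsto h.norm (eventually_atTop.2 ⟨n, fun m hm => ?_⟩)
    have hIco : ∑ k ∈ Finset.range m, R k - ∑ k ∈ Finset.range n, R k
        = ∑ k ∈ Finset.Ico n m, R k := (Finset.sum_Ico_eq_sub _ hm).symm
    have heq : ((ContinuousLinearMap.apply ℂ H x) ∘
        fun m => ∑ k ∈ Finset.range m, R k - ∑ k ∈ Finset.range n, R k) m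
        = ∑ k ∈ Finset.Ico n m, (s k * inner ℂ (v k) x) • v k := by
      simp only [Function.comp_apply, hIco, ContinuousLinearMap.apply_apply,
        sum_apply, hR]
    rw [heq]
    refine hv.norm_sum_smul_inner_le (by positivity) (fun k hk => ?_) x
    rw [hs]
    have : (n : ℝ) ≤ k := by exact_mod_cast (Finset.mem_Ico.1 hk).1
    gcongr

theorem mul_mem_littleOIdeal_of_isCompactOperator {A S : H →L[ℂ] H}
    (hA : IsCompactOperator ⇑A)
    (hS : ∀ n : ℕ, ∃ G : H →L[ℂ] H, LinearMap.rank (G : H →ₗ[ℂ] H) ≤ n ∧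
      ‖S - G‖ ≤ 1 / ((n : ℝ) + 1) ^ 2) :
    A * S ∈ littleOIdeal H ∧ S * A ∈ littleOIdeal H := by
  refine ⟨⟨2, fun ε hε => ?_⟩, ⟨2, fun ε hε => ?_⟩⟩ <;>
    obtain ⟨r, F, hF, hAF⟩ := hA.exists_rank_le_norm_sub_le hε <;>
    filter_upwards [eventually_ge_atTop r] with n hn <;>
    obtain ⟨G, hG, hSG⟩ := hS n <;>
    rw [le_div_iff₀ (by positivity)] at hSG <;>
    have hcard : (r : Cardinal) + n ≤ ((2 * n : ℕ) : Cardinal) := by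
      exact_mod_cast (by omega : r + n ≤ 2 * n)
  · refine ⟨F * S + (A - F) * G, ?_, ?_⟩
    · exact ((LinearMap.rank_add_le ((F * S : H →L[ℂ] H) : H →ₗ[ℂ] H)
        (((A - F) * G : H →L[ℂ] H) : H →ₗ[ℂ] H)).trans
        (add_le_add ((LinearMap.rank_comp_le_left (S : H →ₗ[ℂ] H) (F : H →ₗ[ℂ] H)).trans hF)
          ((LinearMap.rank_comp_le_right (G : H →ₗ[ℂ] H)
            ((A - F : H →L[ℂ] H) : H →ₗ[ℂ] H)).trans hG))).trans hcard
    · rw [show A * S - (F * S + (A - F) * G) = (A - F) * (S - G) by noncomm_ring]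
      calc ‖(A - F) * (S - G)‖ * ((n : ℝ) + 1) ^ 2
          ≤ ‖A - F‖ * ‖S - G‖ * ((n : ℝ) + 1) ^ 2 := by gcongr; exact norm_mul_le _ _
        _ = ‖A - F‖ * (‖S - G‖ * ((n : ℝ) + 1) ^ 2) := mul_assoc _ _ _
        _ ≤ ε * 1 := by gcongr
        _ = ε := mul_one ε
  · refine ⟨S * F + G * (A - F), ?_, ?_⟩
    · exact ((LinearMap.rank_add_le ((S * F : H →L[ℂ] H) : H →ₗ[ℂ] H)
        ((G * (A - F) : H →L[ℂ] H) : H →ₗ[ℂ] H)).trans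
        (add_le_add ((LinearMap.rank_comp_le_right (F : H →ₗ[ℂ] H) (S : H →ₗ[ℂ] H)).trans hF)
          ((LinearMap.rank_comp_le_left ((A - F : H →L[ℂ] H) : H →ₗ[ℂ] H)
            (G : H →ₗ[ℂ] H)).trans hG))).trans hcard
    · rw [show S * A - (S * F + G * (A - F)) = (S - G) * (A - F) by noncomm_ring]
      calc ‖(S - G) * (A - F)‖ * ((n : ℝ) + 1) ^ 2
          ≤ ‖S - G‖ * ‖A - F‖ * ((n : ℝ) + 1) ^ 2 := by gcongr; exact norm_mul_le _ _
        _ = ‖A - F‖ * (‖S - G‖ * ((n : ℝ) + 1) ^ 2) := by ring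
        _ ≤ ε * 1 := by gcongr
        _ = ε := mul_one ε

theorem isBHIdeal_KH : IsBHIdeal (KH (H := H)) :=
  ⟨(compactOperator (RingHom.id ℂ) H H).zero_mem,
    fun _ hx _ hy => (compactOperator (RingHom.id ℂ) H H).add_mem hx hy,
    fun _ hx => (compactOperator (RingHom.id ℂ) H H).neg_mem hx,
    fun A _ hx => ⟨hx.clm_comp A, hx.comp_clm A⟩⟩

end ApproximationNumbers

section Subideals

theorem IsBHIdeal.smul_mem {I : Set (H →L[ℂ] H)} (hI : IsBHIdeal I) (c : ℂ) {x : H →L[ℂ] H}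
    (hx : x ∈ I) : c • x ∈ I := by
  simpa using (hI.2.2.2 (c • 1) x hx).1

theorem IsBHIdeal.sum_mem {I : Set (H →L[ℂ] H)} (hI : IsBHIdeal I) {ι : Type*} (s : Finset ι)
    {f : ι → H →L[ℂ] H} (hf : ∀ i ∈ s, f i ∈ I) : ∑ i ∈ s, f i ∈ I :=
  Finset.sum_induction f (· ∈ I) (fun x y hx hy => hI.2.1 x hx y hy) hI.1 hf

theorem IsBHIdeal.inter {I J : Set (H →L[ℂ] H)} (hI : IsBHIdeal I) (hJ : IsBHIdeal J) :
    IsBHIdeal (I ∩ J) :=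
  ⟨⟨hI.1, hJ.1⟩, fun x hx y hy => ⟨hI.2.1 x hx.1 y hy.1, hJ.2.1 x hx.2 y hy.2⟩,
    fun x hx => ⟨hI.2.2.1 x hx.1, hJ.2.2.1 x hx.2⟩,
    fun A x hx => ⟨⟨(hI.2.2.2 A x hx.1).1, (hJ.2.2.2 A x hx.2).1⟩,
      ⟨(hI.2.2.2 A x hx.1).2, (hJ.2.2.2 A x hx.2).2⟩⟩⟩

theorem mem_genBH {𝒮 : Set (H →L[ℂ] H)} {x : H →L[ℂ] H} (hx : x ∈ 𝒮) : x ∈ genBH 𝒮 :=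
  Set.mem_sInter.2 fun _ hI => hI.2 hx

theorem mul_mem_genBH {𝒮 : Set (H →L[ℂ] H)} (A : H →L[ℂ] H) {x : H →L[ℂ] H}
    (hx : x ∈ genBH 𝒮) : A * x ∈ genBH 𝒮 :=
  Set.mem_sInter.2 fun I hI => (hI.1.2.2.2 A x (Set.mem_sInter.1 hx I hI)).1

theorem genSub_subset_genReal (J 𝒮 : Set (H →L[ℂ] H)) : genSub J 𝒮 ⊆ genReal J 𝒮 :=
  Set.sInter_subset_sInter fun _ hI => ⟨hI.1.1, hI.2⟩

theorem genReal_subset_genLin (J 𝒮 : Set (H →L[ℂ] H)) : genReal J 𝒮 ⊆ genLin J 𝒮 :=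
  Set.sInter_subset_sInter fun I hI =>
    ⟨⟨hI.1.1, fun r x hx => by simpa using hI.1.2 (r : ℂ) x hx⟩, hI.2⟩

theorem genLin_subset_genBH {J 𝒮 : Set (H →L[ℂ] H)} (hJ : IsBHIdeal J) (h𝒮 : 𝒮 ⊆ J) :
    genLin J 𝒮 ⊆ genBH 𝒮 := by
  intro x hx
  refine Set.mem_sInter.2 fun I hI => ?_
  have hIJ := hI.1.inter hJ
  exact (Set.mem_sInter.1 hx (I ∩ J) ⟨⟨⟨Set.inter_subset_right, hIJ.1, hIJ.2.1, hIJ.2.2.1,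
    fun A _ => hIJ.2.2.2 A⟩, fun c _ => hIJ.smul_mem c⟩, Set.subset_inter hI.2 h𝒮⟩).1

/-- The operators that are congruent to a multiple of `S`, with coefficient in `G`, modulo `I`. -/
def scalarCoset (J I : Set (H →L[ℂ] H)) (S : H →L[ℂ] H) (G : AddSubgroup ℂ) :
    Set (H →L[ℂ] H) :=
  {T | T ∈ J ∧ ∃ c ∈ G, T - c • S ∈ I}

theorem isSubideal_scalarCoset {J I : Set (H →L[ℂ] H)} (hJ : IsBHIdeal J) (hI : IsBHIdeal I)
    {S : H →L[ℂ] H} (hS : ∀ A ∈ J, A * S ∈ I ∧ S * A ∈ I) (G : AddSubgroup ℂ) :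
    IsSubideal J (scalarCoset J I S G) := by
  refine ⟨fun _ hx => hx.1, ⟨hJ.1, 0, G.zero_mem, by simpa using hI.1⟩, ?_, ?_, ?_⟩
  · rintro x ⟨hx, c, hc, hxc⟩ y ⟨hy, d, hd, hyd⟩
    refine ⟨hJ.2.1 x hx y hy, c + d, G.add_mem hc hd, ?_⟩
    rw [add_smul, add_sub_add_comm]
    exact hI.2.1 _ hxc _ hyd
  · rintro x ⟨hx, c, hc, hxc⟩
    refine ⟨hJ.2.2.1 x hx, -c, G.neg_mem hc, ?_⟩
    rw [neg_smul, ← neg_sub']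
    exact hI.2.2.1 _ hxc
  · rintro A hA x ⟨hx, c, hc, hxc⟩
    refine ⟨⟨(hJ.2.2.2 A x hx).1, 0, G.zero_mem, ?_⟩, ⟨(hJ.2.2.2 A x hx).2, 0, G.zero_mem, ?_⟩⟩
    · rw [show A * x - (0 : ℂ) • S = A * (x - c • S) + c • (A * S) by
        rw [mul_sub, mul_smul_comm]; simp]
      exact hI.2.1 _ (hI.2.2.2 A _ hxc).1 _ (hI.smul_mem c (hS A hA).1)
    · rw [show x * A - (0 : ℂ) • S = (x - c • S) * A + c • (S * A) by
        rw [sub_mul, smul_mul_assoc]; simp]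
      exact hI.2.1 _ (hI.2.2.2 A _ hxc).2 _ (hI.smul_mem c (hS A hA).2)

theorem self_mem_scalarCoset {J I : Set (H →L[ℂ] H)} (hI : IsBHIdeal I) {S : H →L[ℂ] H}
    (hSJ : S ∈ J) {G : AddSubgroup ℂ} (hG : 1 ∈ G) : S ∈ scalarCoset J I S G :=
  ⟨hSJ, 1, hG, by simpa using hI.1⟩

theorem smul_mem_scalarCoset {J I : Set (H →L[ℂ] H)} (hJ : IsBHIdeal J) (hI : IsBHIdeal I)
    {S : H →L[ℂ] H} {G : AddSubgroup ℂ} {a : ℂ} (ha : ∀ c ∈ G, a * c ∈ G) {T : H →L[ℂ] H}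
    (hT : T ∈ scalarCoset J I S G) : a • T ∈ scalarCoset J I S G := by
  obtain ⟨hT, c, hc, hTc⟩ := hT
  refine ⟨hJ.smul_mem a hT, a * c, ha c hc, ?_⟩
  rw [mul_smul, ← smul_sub]
  exact hI.smul_mem a hTc

theorem smul_mem_scalarCoset_iff {J I : Set (H →L[ℂ] H)} (hJ : IsBHIdeal J) (hI : IsBHIdeal I)
    {S : H →L[ℂ] H} (hSJ : S ∈ J) (hSI : S ∉ I) {G : AddSubgroup ℂ} {a : ℂ} :
    a • S ∈ scalarCoset J I S G ↔ a ∈ G := by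
  refine ⟨fun ⟨_, c, hc, h⟩ => ?_, fun ha => ⟨hJ.smul_mem a hSJ, a, ha, by simpa using hI.1⟩⟩
  rw [← sub_smul] at h
  by_contra ha
  have hac : a - c ≠ 0 := sub_ne_zero.2 fun h => ha (h ▸ hc)
  refine hSI ?_
  simpa [smul_smul, hac] using hI.smul_mem (a - c)⁻¹ h

theorem genBH_ne_JGen {J I : Set (H →L[ℂ] H)} (hJ : IsBHIdeal J) (hI : IsBHIdeal I)
    {S : H →L[ℂ] H} (hSI : S ∉ I) (hS : ∀ A ∈ J, A * S ∈ I ∧ S * A ∈ I) :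
    genBH {S} ≠ JGen J {S} := by
  intro h
  obtain ⟨n, A, X, hAX, hSum⟩ : S ∈ JGen J {S} := h ▸ mem_genBH rfl
  have hW : IsBHIdeal {X : H →L[ℂ] H | ∀ A ∈ J, A * X ∈ I} := by
    refine ⟨fun A _ => by simpa using hI.1, fun x hx y hy A hA => ?_, fun x hx A hA => ?_,
      fun B x hx => ⟨fun A hA => ?_, fun A hA => ?_⟩⟩
    · rw [mul_add]
      exact hI.2.1 _ (hx A hA) _ (hy A hA)
    · rw [mul_neg]
      exact hI.2.2.1 _ (hx A hA)
    · rw [← mul_assoc]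
      exact hx _ (hJ.2.2.2 B A hA).2
    · rw [← mul_assoc]
      exact (hI.2.2.2 B _ (hx A hA)).2
  refine hSI ?_
  rw [hSum]
  exact hI.sum_mem _ fun i _ => Set.mem_sInter.1 (hAX i).2 _
    ⟨hW, by rintro _ rfl; exact fun A hA => (hS A hA).1⟩ _ (hAX i).1

/-- If `S` lies outside an ideal `I` that contains `J S` and `S J`, while neither `P S` nor
`(1 - P) S` lies in `I` for some idempotent `P`, then all inclusions between the subideals of `J`
generated by `S` are strict. -/
theorem strict_inclusions {J I : Set (H →L[ℂ] H)} (hJ : IsBHIdeal J) (hI : IsBHIdeal I)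
    {S P : H →L[ℂ] H} (hSJ : S ∈ J) (hSI : S ∉ I) (hS : ∀ A ∈ J, A * S ∈ I ∧ S * A ∈ I)
    (hP : P * P = P) (hPS : P * S ∉ I) (hPS' : (1 - P) * S ∉ I) :
    genSub J {S} ⊂ genReal J {S} ∧ genReal J {S} ⊂ genLin J {S} ∧ genLin J {S} ⊂ genBH {S} := by
  have hself {G : AddSubgroup ℂ} (hG : 1 ∈ G) : {S} ⊆ scalarCoset J I S G :=
    Set.singleton_subset_iff.2 (self_mem_scalarCoset hI hSJ hG)
  refine ⟨(Set.ssubset_iff_of_subset (genSub_subset_genReal J {S})).2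
      ⟨((1 / 2 : ℝ) : ℂ) • S, ?_, fun h => ?_⟩,
    (Set.ssubset_iff_of_subset (genReal_subset_genLin J {S})).2 ⟨Complex.I • S, ?_, fun h => ?_⟩,
    (Set.ssubset_iff_of_subset (genLin_subset_genBH hJ (Set.singleton_subset_iff.2 hSJ))).2
      ⟨P * S, mul_mem_genBH P (mem_genBH rfl), fun h => ?_⟩⟩
  · refine Set.mem_sInter.2 fun K hK => ?_
    rw [Complex.coe_smul]
    exact hK.1.2 (1 / 2) S (hK.2 rfl)
  · have h := Set.mem_sInter.1 h (scalarCoset J I S (Int.castAddHom ℂ).range)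
      ⟨isSubideal_scalarCoset hJ hI hS _, hself ⟨1, by simp⟩⟩
    obtain ⟨k, hk⟩ := (smul_mem_scalarCoset_iff hJ hI hSJ hSI).1 h
    have hk' : ((k : ℝ) : ℂ) = ((1 / 2 : ℝ) : ℂ) := by simpa using hk
    have hk'' : (k : ℝ) = 1 / 2 := Complex.ofReal_injective hk'
    have : ((2 * k : ℤ) : ℝ) = (1 : ℤ) := by push_cast; linarith
    have : 2 * k = 1 := by exact_mod_cast this
    omega
  · exact Set.mem_sInter.2 fun K hK => hK.1.2 _ S (hK.2 rfl)
  · have h := Set.mem_sInter.1 h (scalarCoset J I S Complex.ofRealHom.toAddMonoidHom.range)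
      ⟨⟨isSubideal_scalarCoset hJ hI hS _, fun r x hx => ?_⟩, hself ⟨1, by simp⟩⟩
    · obtain ⟨r, hr⟩ := (smul_mem_scalarCoset_iff hJ hI hSJ hSI).1 h
      simpa using congrArg Complex.im hr
    · have := smul_mem_scalarCoset hJ hI (a := (r : ℂ))
        (by rintro _ ⟨t, rfl⟩; exact ⟨r * t, by simp⟩) hx
      simpa using this
  · obtain ⟨_, c, -, hc⟩ := Set.mem_sInter.1 h (scalarCoset J I S ⊤)
      ⟨⟨isSubideal_scalarCoset hJ hI hS _, fun a x hx =>
        smul_mem_scalarCoset hJ hI (fun _ _ => AddSubgroup.mem_top _) hx⟩,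
        hself (AddSubgroup.mem_top _)⟩
    by_cases h1 : c = 0
    · exact hPS (by simpa [h1] using hc)
    · have h2 := (hI.2.2.2 (1 - P) _ hc).1
      rw [mul_sub, ← mul_assoc, sub_mul, hP, one_mul, sub_self, zero_mul, zero_sub,
        mul_smul_comm] at h2
      refine hPS' ?_
      simpa [smul_smul, h1] using hI.smul_mem (-c⁻¹) h2

end Subideals

theorem exists_idempotent_even_odd {v : ℕ → H} (hv : Orthonormal ℂ v) :
    ∃ P : H →L[ℂ] H, P * P = P ∧
      ∀ k : ℕ, P (v (2 * k)) = v (2 * k) ∧ P (v (2 * k + 1)) = 0 := by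
  let U := (Submodule.span ℂ (Set.range fun k : ℕ => v (2 * k))).topologicalClosure
  have hU : CompleteSpace U := (Submodule.isClosed_topologicalClosure _).completeSpace_coe
  refine ⟨U.starProjection, U.isIdempotentElem_starProjection, fun k => ⟨?_, ?_⟩⟩
  · exact Submodule.starProjection_eq_self_iff.2
      (Submodule.le_topologicalClosure _ (Submodule.subset_span ⟨k, rfl⟩))
  · rw [Submodule.starProjection_apply_eq_zero_iff, Submodule.orthogonal_closure,
      Submodule.mem_orthogonal]
    intro u hu
    induction hu using Submodule.span_induction with
    | mem x hx =>
      obtain ⟨j, rfl⟩ := hx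
      exact hv.2 (by omega)
    | zero => simp
    | add x y _ _ hx hy => rw [inner_add_left, hx, hy, add_zero]
    | smul a x _ hx => rw [inner_smul_left, hx, mul_zero]

/-- there is a compact operator `S` with `(S)` not `K(H)`-soft, and
consequently the three inclusions `⟨S⟩_{K(H)} ⊆ (S)_{K(H)}^ℝ ⊆ (S)_{K(H)} ⊆ (S)`
are strict. -/
theorem stmt_7 [SeparableSpace H] (hinf : ¬ FiniteDimensional ℂ H) :
    ∃ S : H →L[ℂ] H, IsCompactOperator ⇑S ∧
      genBH {S} ≠ JGen (KH (H := H)) {S} ∧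
      genSub (KH (H := H)) {S} ⊂ genReal (KH (H := H)) {S} ∧
      genReal (KH (H := H)) {S} ⊂ genLin (KH (H := H)) {S} ∧
      genLin (KH (H := H)) {S} ⊂ genBH {S} := by
  obtain ⟨v, hv⟩ := exists_orthonormal_nat hinf
  obtain ⟨S, hScomp, hSv, hSapprox⟩ := exists_isCompactOperator_diagonal hv
  obtain ⟨P, hP, hPv⟩ := exists_idempotent_even_odd hv
  have hmul : ∀ A ∈ KH (H := H), A * S ∈ littleOIdeal H ∧ S * A ∈ littleOIdeal H :=
    fun A hA => mul_mem_littleOIdeal_of_isCompactOperator hA hSapprox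
  have hnorm (k : ℕ) : ‖(1 / ((k : ℂ) + 1) ^ 2)‖ = 1 / ((k : ℝ) + 1) ^ 2 := by
    rw [norm_div, norm_one, norm_pow]
    norm_cast
  have hPS : P * S ∉ littleOIdeal H := by
    refine notMem_littleOIdeal (hv.comp (fun k => 2 * k) fun a b h => by simpa using h)
      (c := 1 / 4) (d := fun k => 1 / (((2 * k : ℕ) : ℂ) + 1) ^ 2) (by norm_num)
      (fun k => ?_) fun k => ?_
    · change P (S (v (2 * k))) = _ • v (2 * k)
      rw [hSv, map_smul, (hPv k).1]
    · rw [hnorm, div_div, show (4 : ℝ) * ((k : ℝ) + 1) ^ 2 = (2 * ((k : ℝ) + 1)) ^ 2 by ring]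
      push_cast
      gcongr
      linarith
  have hPS' : (1 - P) * S ∉ littleOIdeal H := by
    refine notMem_littleOIdeal (hv.comp (fun k => 2 * k + 1) fun a b h => by simpa using h)
      (c := 1 / 4) (d := fun k => 1 / (((2 * k + 1 : ℕ) : ℂ) + 1) ^ 2) (by norm_num)
      (fun k => ?_) fun k => ?_
    · change S (v (2 * k + 1)) - P (S (v (2 * k + 1))) = _ • v (2 * k + 1)
      rw [hSv, map_smul, (hPv k).2, smul_zero, sub_zero]
    · rw [hnorm, div_div, show (4 : ℝ) * ((k : ℝ) + 1) ^ 2 = (2 * ((k : ℝ) + 1)) ^ 2 by ring]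
      push_cast
      gcongr
      linarith
  have hSI : S ∉ littleOIdeal H := fun h => hPS (mul_mem_littleOIdeal P h).1
  exact ⟨S, hScomp, genBH_ne_JGen isBHIdeal_KH isBHIdeal_littleOIdeal hSI hmul,
    strict_inclusions isBHIdeal_KH isBHIdeal_littleOIdeal hScomp hSI hmul hP hPS hPS'⟩
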